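/- arXiv:2411.08460 — 2 statements merged into one kernel-verified Lean document; each statement's English description precedes it below -/
import Mathlib

section
/- Discrete version of Theorem 1. Suppose that for every label y with p_Y(y) > 0 the trapdoor is (δ, y)-effective, i.e. T_f(y, Π_y) − U_f(y) ≥ δ, and ε-natural at y, i.e. Σ_x p_X(x)·(log p_X(x) − log p_X(Π_y(x))) ≤ ε. Then the expected log-posterior of poisoned data is bounded below by that of benign data plus (δ − ε): Σ_y p_Y(y) · Σ_x p_X(x) · log p_f(Π_y(x)|y) ≥ Σ_{x,y} p(x,y) · log p_f(x|y) + (δ − ε). -/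
/-!
Discrete version of Theorem 1 (Trap-MID).

`X` is a finite type of inputs, `Y` a finite type of labels, `p` a joint pmf on
`X × Y` with marginals `pX x = ∑ y, p x y` and `pY y = ∑ x, p x y`.
`pfYX y x` is the model's output posterior `p_f(y|x)` and `pfY y` the output
prior `p_f(y)`, both strictly positive.  `inj y : X → X` is the trigger
injection function `Π_y`.  The model's input posterior is given by Bayes' rule:
`log p_f(x|y) = log p_f(y|x) + log p_X(x) − log p_f(y)`.
-/

theorem trapdoor_expected_log_posterior_bound
    {X Y : Type*} [Fintype X] [Fintype Y]
    (p : X → Y → ℝ) (pfYX : Y → X → ℝ) (pfY : Y → ℝ) (inj : Y → X → X)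
    (δ ε : ℝ) (hε : 0 ≤ ε)
    (hp_nonneg : ∀ x y, 0 ≤ p x y)
    (hp_sum : ∑ x, ∑ y, p x y = 1)
    (hpX_pos : ∀ x, 0 < ∑ y', p x y')
    (hpf_pos : ∀ y x, 0 < pfYX y x)
    (hpfY_pos : ∀ y, 0 < pfY y)
    -- (δ, y)-effectiveness for every y with p_Y(y) > 0:
    -- T_f(y, Π_y) − U_f(y) ≥ δ
    (heff : ∀ y, 0 < ∑ x, p x y →
      (∑ x, (∑ y', p x y') * (Real.log (pfYX y (inj y x)) - Real.log (pfY y)))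
        - (∑ x, (p x y / ∑ x', p x' y) *
            (Real.log (pfYX y x) - Real.log (pfY y))) ≥ δ)
    -- ε-naturalness at every y with p_Y(y) > 0:
    -- Σ_x p_X(x)·(log p_X(x) − log p_X(Π_y(x))) ≤ ε
    (hnat : ∀ y, 0 < ∑ x, p x y →
      ∑ x, (∑ y', p x y') *
        (Real.log (∑ y', p x y') - Real.log (∑ y', p (inj y x) y')) ≤ ε) :
    -- Σ_y p_Y(y) · Σ_x p_X(x) · log p_f(Π_y(x)|y)
    --   ≥ Σ_{x,y} p(x,y) · log p_f(x|y) + (δ − ε)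
    ∑ y, (∑ x, p x y) *
        ∑ x, (∑ y', p x y') *
          (Real.log (pfYX y (inj y x)) + Real.log (∑ y', p (inj y x) y')
            - Real.log (pfY y))
      ≥ (∑ x, ∑ y, p x y *
          (Real.log (pfYX y x) + Real.log (∑ y', p x y') - Real.log (pfY y)))
        + (δ - ε) := by
  have hlabel : ∀ y, ∑ x, p x y * (Real.log (pfYX y x) - Real.log (pfY y))
        + (∑ x, p x y) * (∑ x, (∑ y', p x y') * Real.log (∑ y', p x y'))
        + (∑ x, p x y) * (δ - ε)
      ≤ (∑ x, p x y) * ∑ x, (∑ y', p x y') *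
          (Real.log (pfYX y (inj y x)) + Real.log (∑ y', p (inj y x) y')
            - Real.log (pfY y)) := by
    intro y
    rcases (Finset.sum_nonneg fun x _ => hp_nonneg x y).eq_or_lt with hzero | hpos
    · have hp_zero : ∀ x, p x y = 0 := fun x =>
        (Finset.sum_eq_zero_iff_of_nonneg fun x _ => hp_nonneg x y).1 hzero.symm x
          (Finset.mem_univ x)
      simp [hp_zero]
    · have hcond : ∑ x, p x y * (Real.log (pfYX y x) - Real.log (pfY y))
          = (∑ x, p x y) * ∑ x, (p x y / ∑ x', p x' y) *
              (Real.log (pfYX y x) - Real.log (pfY y)) := by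
        rw [Finset.mul_sum]
        refine Finset.sum_congr rfl fun x _ => ?_
        rw [← mul_assoc, mul_div_cancel₀ _ hpos.ne']
      have hsplit : ∑ x, (∑ y', p x y') *
            (Real.log (pfYX y (inj y x)) + Real.log (∑ y', p (inj y x) y')
              - Real.log (pfY y))
          = (∑ x, (∑ y', p x y') * (Real.log (pfYX y (inj y x)) - Real.log (pfY y)))
            + (∑ x, (∑ y', p x y') * Real.log (∑ y', p x y'))
            - ∑ x, (∑ y', p x y') *
              (Real.log (∑ y', p x y') - Real.log (∑ y', p (inj y x) y')) := by
        rw [← Finset.sum_add_distrib, ← Finset.sum_sub_distrib]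
        exact Finset.sum_congr rfl fun x _ => by ring
      rw [hcond, hsplit, ← mul_add, ← mul_add]
      refine mul_le_mul_of_nonneg_left ?_ hpos.le
      linarith [heff y hpos, hnat y hpos]
  have hY_sum : ∑ y, ∑ x, p x y = 1 := by rw [Finset.sum_comm, hp_sum]
  have hbenign : ∑ x, ∑ y, p x y *
        (Real.log (pfYX y x) + Real.log (∑ y', p x y') - Real.log (pfY y))
      = ∑ y, ∑ x, p x y * (Real.log (pfYX y x) - Real.log (pfY y))
        + ∑ x, (∑ y', p x y') * Real.log (∑ y', p x y') := by
    rw [Finset.sum_comm (s := (Finset.univ : Finset Y)), ← Finset.sum_add_distrib]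
    refine Finset.sum_congr rfl fun x _ => ?_
    rw [Finset.sum_mul, ← Finset.sum_add_distrib]
    exact Finset.sum_congr rfl fun y _ => by ring
  have htotal := Finset.sum_le_sum fun y (_ : y ∈ Finset.univ) => hlabel y
  rw [Finset.sum_add_distrib, Finset.sum_add_distrib, ← Finset.sum_mul, ← Finset.sum_mul,
    hY_sum, one_mul, one_mul] at htotal
  rw [hbenign]
  exact htotal
end

section
/- Strict-advantage corollary of Theorem 1 (Section 3.4 discussion). Suppose that for every label y with p_Y(y) > 0 the trapdoor is (δ, y)-effective and ε-natural at y, and additionally δ > ε. Then the expected log-posterior of poisoned data strictly exceeds that of benign data: Σ_y p_Y(y) · Σ_x p_X(x) · log p_f(Π_y(x)|y) > Σ_{x,y} p(x,y) · log p_f(x|y). -/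
/-!
Strict-advantage corollary of Theorem 1.

If for every label `y` with `p_Y(y) > 0` the trapdoor is (δ, y)-effective and
ε-natural at `y`, and moreover `δ > ε`, then the expected log-posterior of
poisoned data strictly exceeds that of benign data.
-/

theorem trapdoor_strict_advantage
    {X Y : Type*} [Fintype X] [Fintype Y]
    (p : X → Y → ℝ) (pfYX : Y → X → ℝ) (pfY : Y → ℝ) (inj : Y → X → X)
    (δ ε : ℝ) (hε : 0 ≤ ε) (hδε : δ > ε)
    (hp_nonneg : ∀ x y, 0 ≤ p x y)
    (hp_sum : ∑ x, ∑ y, p x y = 1)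
    (hpX_pos : ∀ x, 0 < ∑ y', p x y')
    (hpf_pos : ∀ y x, 0 < pfYX y x)
    (hpfY_pos : ∀ y, 0 < pfY y)
    -- (δ, y)-effectiveness for every y with p_Y(y) > 0
    (heff : ∀ y, 0 < ∑ x, p x y →
      (∑ x, (∑ y', p x y') * (Real.log (pfYX y (inj y x)) - Real.log (pfY y)))
        - (∑ x, (p x y / ∑ x', p x' y) *
            (Real.log (pfYX y x) - Real.log (pfY y))) ≥ δ)
    -- ε-naturalness at every y with p_Y(y) > 0
    (hnat : ∀ y, 0 < ∑ x, p x y →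
      ∑ x, (∑ y', p x y') *
        (Real.log (∑ y', p x y') - Real.log (∑ y', p (inj y x) y')) ≤ ε) :
    -- Σ_y p_Y(y) · Σ_x p_X(x) · log p_f(Π_y(x)|y) > Σ_{x,y} p(x,y) · log p_f(x|y)
    ∑ y, (∑ x, p x y) *
        ∑ x, (∑ y', p x y') *
          (Real.log (pfYX y (inj y x)) + Real.log (∑ y', p (inj y x) y')
            - Real.log (pfY y))
      > ∑ x, ∑ y, p x y *
          (Real.log (pfYX y x) + Real.log (∑ y', p x y') - Real.log (pfY y)) := by
  have hY_sum : ∑ y, ∑ x, p x y = 1 := by rw [Finset.sum_comm]; exact hp_sum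
  have hbenign : ∑ x, ∑ y, p x y *
        (Real.log (pfYX y x) + Real.log (∑ y', p x y') - Real.log (pfY y))
      = ∑ y, ((∑ x, p x y) * (∑ x, (∑ y', p x y') * Real.log (∑ y', p x y'))
          + ∑ x, p x y * (Real.log (pfYX y x) - Real.log (pfY y))) := by
    rw [Finset.sum_add_distrib, ← Finset.sum_mul, hY_sum, one_mul,
      Finset.sum_comm (s := (Finset.univ : Finset Y)), ← Finset.sum_add_distrib]
    refine Finset.sum_congr rfl fun x _ => ?_
    rw [Finset.sum_mul, ← Finset.sum_add_distrib]
    exact Finset.sum_congr rfl fun y _ => by ring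
  have hlabel : ∀ y, (∑ x, p x y) * (δ - ε) +
      ((∑ x, p x y) * (∑ x, (∑ y', p x y') * Real.log (∑ y', p x y'))
          + ∑ x, p x y * (Real.log (pfYX y x) - Real.log (pfY y)))
      ≤ (∑ x, p x y) * ∑ x, (∑ y', p x y') *
          (Real.log (pfYX y (inj y x)) + Real.log (∑ y', p (inj y x) y')
            - Real.log (pfY y)) := by
    intro y
    rcases (Finset.sum_nonneg fun x _ => hp_nonneg x y :
      0 ≤ ∑ x, p x y).eq_or_lt with h0 | hpos
    · have hzero : ∀ x, p x y = 0 := fun x =>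
        (Finset.sum_eq_zero_iff_of_nonneg fun x _ => hp_nonneg x y).1 h0.symm x
          (Finset.mem_univ x)
      simp [hzero]
    · have hcond : ∑ x, p x y * (Real.log (pfYX y x) - Real.log (pfY y))
          = (∑ x, p x y) * ∑ x, (p x y / ∑ x', p x' y) *
            (Real.log (pfYX y x) - Real.log (pfY y)) := by
        rw [Finset.mul_sum]
        refine Finset.sum_congr rfl fun x _ => ?_
        rw [← mul_assoc, mul_div_cancel₀ _ hpos.ne']
      have hsplit : ∑ x, (∑ y', p x y') *
          (Real.log (pfYX y (inj y x)) + Real.log (∑ y', p (inj y x) y')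
            - Real.log (pfY y))
          = ∑ x, (∑ y', p x y') * (Real.log (pfYX y (inj y x)) - Real.log (pfY y))
            + ∑ x, (∑ y', p x y') * Real.log (∑ y', p x y')
            - ∑ x, (∑ y', p x y') *
              (Real.log (∑ y', p x y') - Real.log (∑ y', p (inj y x) y')) := by
        rw [← Finset.sum_add_distrib, ← Finset.sum_sub_distrib]
        exact Finset.sum_congr rfl fun x _ => by ring
      rw [hcond, hsplit, ← mul_add, ← mul_add]
      refine mul_le_mul_of_nonneg_left ?_ hpos.le
      linarith [heff y hpos, hnat y hpos]
  have hsum := Finset.sum_le_sum fun y (_ : y ∈ (Finset.univ : Finset Y)) => hlabel y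
  rw [Finset.sum_add_distrib, ← Finset.sum_mul, hY_sum, one_mul] at hsum
  rw [hbenign]
  linarith
end
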